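/- For every w ∈ U and every t ≥ 0, the sharp flow satisfies the two-sided exponential bounds e^{−ℓt}‖∇f(w)‖_{F_s^†(w)} ≤ ‖∇f(ψ_t(w))‖_{F_s^†(ψ_t(w))} ≤ e^{−γt}‖∇f(w)‖_{F_s^†(w)}, where γ := λ_{H_F,s} − δ_{F_s}/2 and ℓ := L_{H_F,s} + δ_{F_s}/2. -/

import Mathlib

open Matrix Set Filter

/-- Entrywise directional derivative `∇A(w)[v]` of a matrix-valued map. -/
noncomputable def matDeriv {p : ℕ} (A : (Fin p → ℝ) → Matrix (Fin p) (Fin p) ℝ)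
    (w v : Fin p → ℝ) : Matrix (Fin p) (Fin p) ℝ :=
  fun i j => fderiv ℝ (fun x => A x i j) w v

/-- Euclidean gradient `∇f(w)`. -/
noncomputable def gradVec {p : ℕ} (f : (Fin p → ℝ) → ℝ) (w : Fin p → ℝ) : Fin p → ℝ :=
  fun j => fderiv ℝ f w (Pi.single j 1)

/-- Euclidean Hessian `∇²f(w)`. -/
noncomputable def hessMat {p : ℕ} (f : (Fin p → ℝ) → ℝ) (w : Fin p → ℝ) :
    Matrix (Fin p) (Fin p) ℝ :=
  fun i j => fderiv ℝ (fun x => fderiv ℝ f x (Pi.single j 1)) w (Pi.single i 1)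

/-- `‖v‖_M = √(vᵀ M v)`. -/
noncomputable def mnorm {p : ℕ} (M : Matrix (Fin p) (Fin p) ℝ) (v : Fin p → ℝ) : ℝ :=
  Real.sqrt (v ⬝ᵥ M *ᵥ v)

theorem le_exp_mul_of_hasDerivAt_le {V V' : ℝ → ℝ} {c : ℝ}
    (hV : ∀ t, 0 ≤ t → HasDerivAt V (V' t) t) (hle : ∀ t, 0 ≤ t → V' t ≤ -c * V t)
    {t : ℝ} (ht : 0 ≤ t) : V t ≤ Real.exp (-c * t) * V 0 := by
  have hd : ∀ s, 0 ≤ s → HasDerivAt (fun x => Real.exp (c * x) * V x)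
      (Real.exp (c * s) * c * V s + Real.exp (c * s) * V' s) s := fun s hs => by
    have h1 : HasDerivAt (fun x => c * x) c s := by
      simpa using (hasDerivAt_id s).const_mul c
    exact h1.exp.mul (hV s hs)
  have hanti : AntitoneOn (fun x => Real.exp (c * x) * V x) (Ici 0) := by
    refine antitoneOn_of_deriv_nonpos (convex_Ici 0)
      (fun s hs => (hd s hs).continuousAt.continuousWithinAt)
      (fun s hs => (hd s (interior_subset hs)).differentiableAt.differentiableWithinAt)
      (fun s hs => ?_)
    have hs' : 0 ≤ s := interior_subset hs
    rw [(hd s hs').deriv]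
    nlinarith [hle s hs', Real.exp_pos (c * s)]
  have h := hanti (mem_Ici.2 le_rfl) (mem_Ici.2 ht) ht
  simp only [mul_zero, Real.exp_zero, one_mul] at h
  rw [neg_mul, Real.exp_neg]
  rwa [inv_mul_eq_div, le_div_iff₀' (Real.exp_pos _)]

theorem exp_mul_le_of_le_hasDerivAt {V V' : ℝ → ℝ} {c : ℝ}
    (hV : ∀ t, 0 ≤ t → HasDerivAt V (V' t) t) (hle : ∀ t, 0 ≤ t → -c * V t ≤ V' t)
    {t : ℝ} (ht : 0 ≤ t) : Real.exp (-c * t) * V 0 ≤ V t := by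
  have h := le_exp_mul_of_hasDerivAt_le (V := fun s => -V s) (V' := fun s => -V' s) (c := c)
    (fun s hs => (hV s hs).neg) (fun s hs => by linarith [hle s hs]) ht
  linarith

theorem mnorm_sq {p : ℕ} {M : Matrix (Fin p) (Fin p) ℝ} {v : Fin p → ℝ}
    (h : 0 ≤ v ⬝ᵥ M *ᵥ v) : mnorm M v ^ 2 = v ⬝ᵥ M *ᵥ v :=
  Real.sq_sqrt h

theorem mnorm_neg {p : ℕ} (M : Matrix (Fin p) (Fin p) ℝ) (v : Fin p → ℝ) :
    mnorm M (-v) = mnorm M v := by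
  simp [mnorm, mulVec_neg]

theorem Matrix.PosDef.dotProduct_mulVec_nonneg_real {p : ℕ} {M : Matrix (Fin p) (Fin p) ℝ}
    (hM : M.PosDef) (v : Fin p → ℝ) : 0 ≤ v ⬝ᵥ M *ᵥ v := by
  simpa using hM.posSemidef.dotProduct_mulVec_nonneg v

theorem Matrix.PosDef.transpose_eq {p : ℕ} {M : Matrix (Fin p) (Fin p) ℝ}
    (hM : M.PosDef) : Mᵀ = M := by
  simpa [Matrix.IsHermitian, conjTranspose_eq_transpose_of_trivial] using hM.isHermitian

theorem dotProduct_mulVec_comm_of_transpose_eq {p : ℕ} {M : Matrix (Fin p) (Fin p) ℝ}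
    (hM : Mᵀ = M) (a b : Fin p → ℝ) : a ⬝ᵥ M *ᵥ b = b ⬝ᵥ M *ᵥ a := by
  rw [dotProduct_mulVec, ← mulVec_transpose, hM, dotProduct_comm]

/-- Cauchy–Schwarz for the dual pair of norms of `M` and `M⁻¹`. -/
theorem abs_dotProduct_le_mnorm_inv_mul_mnorm {p : ℕ} {M : Matrix (Fin p) (Fin p) ℝ}
    (hM : M.PosDef) (a b : Fin p → ℝ) : |a ⬝ᵥ b| ≤ mnorm M⁻¹ a * mnorm M b := by
  have hdet : IsUnit M.det := hM.det_pos.ne'.isUnit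
  have hcancel : M *ᵥ (M⁻¹ *ᵥ a) = a := by
    rw [mulVec_mulVec, mul_nonsing_inv _ hdet, one_mulVec]
  have hMb : (M⁻¹ *ᵥ a) ⬝ᵥ M *ᵥ b = a ⬝ᵥ b := by
    rw [dotProduct_mulVec_comm_of_transpose_eq hM.transpose_eq, hcancel, dotProduct_comm]
  have hquad : ∀ s : ℝ,
      0 ≤ (b ⬝ᵥ M *ᵥ b) * (s * s) + (2 * (a ⬝ᵥ b)) * s + a ⬝ᵥ M⁻¹ *ᵥ a := fun s => by
    have h := hM.dotProduct_mulVec_nonneg_real (M⁻¹ *ᵥ a + s • b)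
    simp only [mulVec_add, mulVec_smul, hcancel, add_dotProduct, dotProduct_add,
      smul_dotProduct, dotProduct_smul, smul_eq_mul, hMb, dotProduct_comm (M⁻¹ *ᵥ a) a,
      dotProduct_comm b a] at h
    linarith
  have hdisc := discrim_le_zero hquad
  rw [discrim] at hdisc
  rw [mnorm, mnorm, ← Real.sqrt_mul (hM.inv.dotProduct_mulVec_nonneg_real a)]
  apply Real.abs_le_sqrt
  linarith

theorem hasDerivAt_dotProduct {p : ℕ} {a b : ℝ → Fin p → ℝ} {a' b' : Fin p → ℝ} {t : ℝ}
    (ha : HasDerivAt a a' t) (hb : HasDerivAt b b' t) :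
    HasDerivAt (fun s => a s ⬝ᵥ b s) (a' ⬝ᵥ b t + a t ⬝ᵥ b') t := by
  simp only [dotProduct, ← Finset.sum_add_distrib]
  exact HasDerivAt.fun_sum fun i _ => (hasDerivAt_pi.1 ha i).mul (hasDerivAt_pi.1 hb i)

theorem hasDerivAt_mulVec {p : ℕ} {A : ℝ → Matrix (Fin p) (Fin p) ℝ}
    {A' : Matrix (Fin p) (Fin p) ℝ} {b : ℝ → Fin p → ℝ} {b' : Fin p → ℝ} {t : ℝ}
    (hA : ∀ i j, HasDerivAt (fun s => A s i j) (A' i j) t) (hb : HasDerivAt b b' t) :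
    HasDerivAt (fun s => A s *ᵥ b s) (A' *ᵥ b t + A t *ᵥ b') t :=
  hasDerivAt_pi.2 fun i => hasDerivAt_dotProduct (hasDerivAt_pi.2 (hA i)) hb

theorem differentiableAt_det {n : Type*} [Fintype n] [DecidableEq n] {A : ℝ → Matrix n n ℝ}
    {t : ℝ} (hA : ∀ i j, DifferentiableAt ℝ (fun s => A s i j) t) :
    DifferentiableAt ℝ (fun s => (A s).det) t := by
  simp only [det_apply]
  exact DifferentiableAt.fun_sum fun σ _ =>
    (DifferentiableAt.fun_finsetProd fun i _ => hA (σ i) i).const_smul (Equiv.Perm.sign σ)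

theorem differentiableAt_matrix_inv {n : Type*} [Fintype n] [DecidableEq n]
    {A : ℝ → Matrix n n ℝ} {t : ℝ} (hA : ∀ i j, DifferentiableAt ℝ (fun s => A s i j) t)
    (hdet : (A t).det ≠ 0) (i j : n) : DifferentiableAt ℝ (fun s => (A s)⁻¹ i j) t := by
  simp only [inv_def, Ring.inverse_eq_inv', Matrix.smul_apply, smul_eq_mul, adjugate_apply]
  refine ((differentiableAt_det hA).inv hdet).mul (differentiableAt_det fun k l => ?_)
  by_cases hk : k = j
  · subst hk
    simp
  · simpa [updateRow_ne hk] using hA k l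

theorem matDeriv_transpose_of_eventually {p : ℕ} {A : (Fin p → ℝ) → Matrix (Fin p) (Fin p) ℝ}
    {w : Fin p → ℝ} (hA : ∀ᶠ x in nhds w, (A x)ᵀ = A x) (v : Fin p → ℝ) :
    (matDeriv A w v)ᵀ = matDeriv A w v := by
  ext i j
  have h : (fun x => A x j i) =ᶠ[nhds w] fun x => A x i j := by
    filter_upwards [hA] with x hx
    exact congrFun (congrFun hx i) j
  simp only [transpose_apply, matDeriv, h.fderiv_eq]

theorem hasDerivAt_gradVec_comp {p : ℕ} {f : (Fin p → ℝ) → ℝ} {y : ℝ → Fin p → ℝ}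
    {y' : Fin p → ℝ} {t : ℝ} (hf : AnalyticAt ℝ f (y t)) (hy : HasDerivAt y y' t) :
    HasDerivAt (fun s => gradVec f (y s)) (y' ᵥ* hessMat f (y t)) t := by
  refine hasDerivAt_pi.2 fun j => ?_
  have hd : DifferentiableAt ℝ (fun x => fderiv ℝ f x (Pi.single j 1)) (y t) :=
    hf.fderiv.differentiableAt.clm_apply (differentiableAt_const _)
  have hsum : fderiv ℝ (fun x => fderiv ℝ f x (Pi.single j 1)) (y t) y' =
      (y' ᵥ* hessMat f (y t)) j := by
    conv_lhs => rw [pi_eq_sum_univ' y', map_sum]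
    simp [vecMul, dotProduct, hessMat]
  exact hsum ▸ hd.hasFDerivAt.comp_hasDerivAt t hy

/-- Derivative of `‖∇f‖²` in the metric `Pₛ F⁻¹ Pₛ` along a trajectory of the sharp flow. -/
theorem hasDerivAt_sharp_energy {p : ℕ} {F Ps : (Fin p → ℝ) → Matrix (Fin p) (Fin p) ℝ}
    {f : (Fin p → ℝ) → ℝ} {y : ℝ → Fin p → ℝ} {t : ℝ} {u : Fin p → ℝ}
    (hF : ∀ i j, DifferentiableAt ℝ (fun x => F x i j) (y t))
    (hFpos : ∀ x, (F x).PosDef) (hf : AnalyticAt ℝ f (y t))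
    (hP : ∀ i j, DifferentiableAt ℝ (fun x => Ps x i j) (y t))
    (hPsymm : ∀ᶠ x in nhds (y t), (Ps x)ᵀ = Ps x)
    (hu : u = (F (y t))⁻¹ *ᵥ (Ps (y t) *ᵥ gradVec f (y t)))
    (hPu : Ps (y t) *ᵥ u = u)
    (hy : HasDerivAt y (-u) t) :
    HasDerivAt (fun s => gradVec f (y s) ⬝ᵥ
        (Ps (y s) * (F (y s))⁻¹ * Ps (y s)) *ᵥ gradVec f (y s))
      (-(2 * (u ⬝ᵥ hessMat f (y t) *ᵥ u))
        + 2 * (gradVec f (y t) ⬝ᵥ matDeriv Ps (y t) (-u) *ᵥ u)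
        - u ⬝ᵥ matDeriv F (y t) (-u) *ᵥ u) t := by
  have hdF : ∀ i j, HasDerivAt (fun s => F (y s) i j) (matDeriv F (y t) (-u) i j) t :=
    fun i j => (hF i j).hasFDerivAt.comp_hasDerivAt t hy
  have hdP : ∀ i j, HasDerivAt (fun s => Ps (y s) i j) (matDeriv Ps (y t) (-u) i j) t :=
    fun i j => (hP i j).hasFDerivAt.comp_hasDerivAt t hy
  have hdg := hasDerivAt_gradVec_comp hf hy
  have hdPg := hasDerivAt_mulVec hdP hdg
  have hdu := hasDerivAt_mulVec (fun i j => (differentiableAt_matrix_inv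
    (fun i j => (hdF i j).differentiableAt) (hFpos (y t)).det_pos.ne' i j).hasDerivAt) hdPg
  set u' := (fun i j => deriv (fun s => (F (y s))⁻¹ i j) t : Matrix (Fin p) (Fin p) ℝ) *ᵥ
      (Ps (y t) *ᵥ gradVec f (y t)) + (F (y t))⁻¹ *ᵥ
      (matDeriv Ps (y t) (-u) *ᵥ gradVec f (y t) + Ps (y t) *ᵥ (-u ᵥ* hessMat f (y t)))
  have hcancel : ∀ x v, F x *ᵥ ((F x)⁻¹ *ᵥ v) = v := fun x v => by
    rw [mulVec_mulVec, mul_nonsing_inv _ (hFpos x).det_pos.ne'.isUnit, one_mulVec]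
  have hFu := hasDerivAt_mulVec hdF hdu
  simp only [hcancel] at hFu
  have hlin := hFu.unique hdPg
  rw [← hu] at hlin
  have hV := hasDerivAt_dotProduct hdg (hasDerivAt_mulVec hdP hdu)
  rw [← hu, hPu] at hV
  have hPt := hPsymm.self_of_nhds
  have hP't := matDeriv_transpose_of_eventually hPsymm (-u)
  have hFt := (hFpos (y t)).transpose_eq
  simp only [← mulVec_mulVec]
  convert hV using 1
  have hFu_t : F (y t) *ᵥ u = Ps (y t) *ᵥ gradVec f (y t) := by rw [hu, hcancel]
  have hgu' : gradVec f (y t) ⬝ᵥ Ps (y t) *ᵥ u' = u ⬝ᵥ F (y t) *ᵥ u' := by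
    rw [dotProduct_mulVec_comm_of_transpose_eq hPt, ← hFu_t,
      dotProduct_mulVec_comm_of_transpose_eq hFt]
  have hlin' := congrArg (fun v => u ⬝ᵥ v) hlin
  simp only [dotProduct_add] at hlin'
  rw [dotProduct_mulVec_comm_of_transpose_eq hPt u, hPu,
    dotProduct_mulVec_comm_of_transpose_eq hP't u] at hlin'
  have hH : (-u ᵥ* hessMat f (y t)) ⬝ᵥ u = -(u ⬝ᵥ hessMat f (y t) *ᵥ u) := by
    rw [← dotProduct_mulVec, neg_dotProduct]
  rw [dotProduct_add, hgu']
  linarith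

/-- The terms coming from the variation of `Pₛ` and `F` are controlled by the energy `u ⬝ᵥ M u`. -/
theorem abs_metric_variation_le {p : ℕ} {M P' M' : Matrix (Fin p) (Fin p) ℝ}
    {g u : Fin p → ℝ} {G δ δF : ℝ} (hM : M.PosDef) (hG : 0 < G) (hδF : 0 ≤ δF)
    (hg : mnorm M⁻¹ g ≤ G) (hgu : g ⬝ᵥ u = u ⬝ᵥ M *ᵥ u)
    (hP' : mnorm M (P' *ᵥ u) ≤ δ / G * (mnorm M u * mnorm M u))
    (hM' : mnorm M⁻¹ (M' *ᵥ u) ≤ δF / G * (mnorm M u * mnorm M u)) :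
    |2 * (g ⬝ᵥ P' *ᵥ u) - u ⬝ᵥ M' *ᵥ u| ≤ (2 * δ + δF) * (u ⬝ᵥ M *ᵥ u) := by
  have hsq := mnorm_sq (hM.dotProduct_mulVec_nonneg_real u)
  have hn : 0 ≤ mnorm M u := Real.sqrt_nonneg _
  have hnG : mnorm M u ≤ G := by
    have h1 := (le_abs_self _).trans (abs_dotProduct_le_mnorm_inv_mul_mnorm hM g u)
    rw [hgu, ← hsq] at h1
    by_contra! hlt
    nlinarith
  have h1 : |g ⬝ᵥ P' *ᵥ u| ≤ δ * mnorm M u ^ 2 :=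
    calc |g ⬝ᵥ P' *ᵥ u| ≤ mnorm M⁻¹ g * mnorm M (P' *ᵥ u) :=
          abs_dotProduct_le_mnorm_inv_mul_mnorm hM _ _
      _ ≤ G * (δ / G * (mnorm M u * mnorm M u)) :=
          mul_le_mul hg hP' (Real.sqrt_nonneg _) hG.le
      _ = δ * mnorm M u ^ 2 := by field_simp
  have h2 : |u ⬝ᵥ M' *ᵥ u| ≤ δF * mnorm M u ^ 2 :=
    calc |u ⬝ᵥ M' *ᵥ u| = |(M' *ᵥ u) ⬝ᵥ u| := by rw [dotProduct_comm]
      _ ≤ mnorm M⁻¹ (M' *ᵥ u) * mnorm M u := abs_dotProduct_le_mnorm_inv_mul_mnorm hM _ _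
      _ ≤ δF / G * (mnorm M u * mnorm M u) * G :=
          mul_le_mul hM' hnG hn (by positivity)
      _ = δF * mnorm M u ^ 2 := by field_simp
  rw [← hsq]
  rw [abs_le] at h1 h2 ⊢
  constructor <;> linarith [h1.1, h1.2, h2.1, h2.2]

/-- Two-sided exponential decay of `‖∇f(ψ_t(w))‖_{F_s†(ψ_t(w))}` along the sharp flow,
with rates `γ = λ_{H_F,s} − δ_{F_s}/2` and `ℓ = L_{H_F,s} + δ_{F_s}/2`,
where `δ_{F_s} = 2δ + δ_F`. -/
theorem sharp_flow_two_sided_exponential_decay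
    {p : ℕ} (U : Set (Fin p → ℝ)) (hU : IsOpen U)
    (F Ps : (Fin p → ℝ) → Matrix (Fin p) (Fin p) ℝ)
    (f : (Fin p → ℝ) → ℝ)
    (G δ δF : ℝ) (hG : 0 < G) (hδ : 0 ≤ δ) (hδF : 0 ≤ δF)
    (hFsmooth : ∀ i j, ContDiff ℝ (⊤ : ℕ∞) fun w => F w i j)
    (hFpos : ∀ w, (F w).PosDef)
    (hfan : AnalyticOnNhd ℝ f U)
    (hPssmooth : ∀ w ∈ U, ∀ i j, ContDiffAt ℝ (⊤ : ℕ∞) (fun x => Ps x i j) w)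
    (hPsproj : ∀ w ∈ U, Ps w * Ps w = Ps w)
    (hPssymm : ∀ w ∈ U, (Ps w)ᵀ = Ps w)
    (hcomm : ∀ w ∈ U, Ps w * F w = F w * Ps w)
    (hgradG : ∀ w ∈ U, mnorm ((F w)⁻¹) (gradVec f w) ≤ G)
    (hPsb : ∀ w ∈ U, ∀ u v : Fin p → ℝ,
      mnorm (F w) (matDeriv Ps w u *ᵥ v) ≤ δ / G * (mnorm (F w) u * mnorm (F w) v))
    (hFb : ∀ w ∈ U, ∀ u v : Fin p → ℝ,
      mnorm ((F w)⁻¹) (matDeriv F w u *ᵥ v) ≤ δF / G * (mnorm (F w) u * mnorm (F w) v))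
    (lamHFs LHFs : ℝ) (hlamHFs : 0 < lamHFs)
    (hHFs : ∀ w ∈ U, ∀ v : Fin p → ℝ, Ps w *ᵥ v = v →
      lamHFs * (v ⬝ᵥ F w *ᵥ v) ≤ v ⬝ᵥ hessMat f w *ᵥ v ∧
      v ⬝ᵥ hessMat f w *ᵥ v ≤ LHFs * (v ⬝ᵥ F w *ᵥ v))
    (ψ : ℝ → (Fin p → ℝ) → Fin p → ℝ)
    (hψ0 : ∀ w ∈ U, ψ 0 w = w)
    (hψU : ∀ w ∈ U, ∀ t : ℝ, 0 ≤ t → ψ t w ∈ U)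
    (hψode : ∀ w ∈ U, ∀ t : ℝ, 0 ≤ t →
      HasDerivAt (fun s => ψ s w)
        (-((Ps (ψ t w) * (F (ψ t w))⁻¹ * Ps (ψ t w)) *ᵥ gradVec f (ψ t w))) t)
    :
    ∀ w ∈ U, ∀ t : ℝ, 0 ≤ t →
      Real.exp (-(LHFs + (2 * δ + δF) / 2) * t)
          * mnorm (Ps w * (F w)⁻¹ * Ps w) (gradVec f w)
        ≤ mnorm (Ps (ψ t w) * (F (ψ t w))⁻¹ * Ps (ψ t w)) (gradVec f (ψ t w)) ∧
      mnorm (Ps (ψ t w) * (F (ψ t w))⁻¹ * Ps (ψ t w)) (gradVec f (ψ t w))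
        ≤ Real.exp (-(lamHFs - (2 * δ + δF) / 2) * t)
          * mnorm (Ps w * (F w)⁻¹ * Ps w) (gradVec f w) := by
  intro w hw
  let y : ℝ → Fin p → ℝ := fun s => ψ s w
  let g : ℝ → Fin p → ℝ := fun s => gradVec f (y s)
  let u : ℝ → Fin p → ℝ := fun s => (F (y s))⁻¹ *ᵥ (Ps (y s) *ᵥ g s)
  let V : ℝ → ℝ := fun s => g s ⬝ᵥ (Ps (y s) * (F (y s))⁻¹ * Ps (y s)) *ᵥ g s
  have hyU : ∀ s, 0 ≤ s → y s ∈ U := hψU w hw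
  have hdet : ∀ x, IsUnit (F x).det := fun x => (hFpos x).det_pos.ne'.isUnit
  have hPu : ∀ s, 0 ≤ s → Ps (y s) *ᵥ u s = u s := fun s hs => by
    have hc : Ps (y s) * (F (y s))⁻¹ = (F (y s))⁻¹ * Ps (y s) := by
      calc Ps (y s) * (F (y s))⁻¹
          = (F (y s))⁻¹ * (F (y s) * Ps (y s)) * (F (y s))⁻¹ := by
            rw [nonsing_inv_mul_cancel_left _ _ (hdet _)]
        _ = (F (y s))⁻¹ * Ps (y s) := by
            rw [← hcomm _ (hyU s hs), ← Matrix.mul_assoc,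
              mul_nonsing_inv_cancel_right _ _ (hdet _)]
    simp only [u, mulVec_mulVec]
    rw [← Matrix.mul_assoc, hc, Matrix.mul_assoc, hPsproj _ (hyU s hs)]
  have hAg : ∀ s, 0 ≤ s → (Ps (y s) * (F (y s))⁻¹ * Ps (y s)) *ᵥ g s = u s := fun s hs => by
    rw [← mulVec_mulVec, ← mulVec_mulVec]
    exact hPu s hs
  have hgu : ∀ s, 0 ≤ s → g s ⬝ᵥ u s = u s ⬝ᵥ F (y s) *ᵥ u s := fun s hs => by
    have hFu : F (y s) *ᵥ u s = Ps (y s) *ᵥ g s := by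
      simp only [u]
      rw [mulVec_mulVec, mul_nonsing_inv _ (hdet _), one_mulVec]
    rw [hFu, dotProduct_mulVec_comm_of_transpose_eq (hPssymm _ (hyU s hs)), hPu s hs]
  have hVu : ∀ s, 0 ≤ s → V s = u s ⬝ᵥ F (y s) *ᵥ u s := fun s hs => by
    simp only [V]
    rw [hAg s hs, hgu s hs]
  have hdV : ∀ s, 0 ≤ s → HasDerivAt V
      (-(2 * (u s ⬝ᵥ hessMat f (y s) *ᵥ u s))
        + 2 * (g s ⬝ᵥ matDeriv Ps (y s) (-u s) *ᵥ u s)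
        - u s ⬝ᵥ matDeriv F (y s) (-u s) *ᵥ u s) s := fun s hs => by
    have hy := hψode w hw s hs
    rw [hAg s hs] at hy
    refine hasDerivAt_sharp_energy
      (fun i j => (hFsmooth i j).contDiffAt.differentiableAt (by simp)) hFpos
      (hfan _ (hyU s hs))
      (fun i j => (hPssmooth _ (hyU s hs) i j).differentiableAt (by simp)) ?_ rfl (hPu s hs) hy
    filter_upwards [hU.mem_nhds (hyU s hs)] with x hx using hPssymm x hx
  have hvar : ∀ s, 0 ≤ s → |2 * (g s ⬝ᵥ matDeriv Ps (y s) (-u s) *ᵥ u s)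
      - u s ⬝ᵥ matDeriv F (y s) (-u s) *ᵥ u s| ≤ (2 * δ + δF) * V s := fun s hs => by
    rw [hVu s hs]
    have h1 := hPsb _ (hyU s hs) (-u s) (u s)
    have h2 := hFb _ (hyU s hs) (-u s) (u s)
    rw [mnorm_neg] at h1 h2
    exact abs_metric_variation_le (hFpos _) hG hδF (hgradG _ (hyU s hs)) (hgu s hs) h1 h2
  have hV0 : V 0 = gradVec f w ⬝ᵥ (Ps w * (F w)⁻¹ * Ps w) *ᵥ gradVec f w := by
    simp only [V, g, y, hψ0 w hw]
  have hsqrt : ∀ c t x : ℝ,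
      Real.sqrt (Real.exp (-(2 * c) * t) * x) = Real.exp (-c * t) * Real.sqrt x := fun c t x => by
    rw [Real.sqrt_mul (Real.exp_pos _).le, ← Real.exp_half]
    ring_nf
  intro t ht
  simp only [mnorm]
  rw [← hV0, ← hsqrt, ← hsqrt]
  constructor
  · refine Real.sqrt_le_sqrt (exp_mul_le_of_le_hasDerivAt hdV (fun s hs => ?_) ht)
    have h1 := (hHFs _ (hyU s hs) _ (hPu s hs)).2
    rw [← hVu s hs] at h1
    linarith [(abs_le.1 (hvar s hs)).1]
  · refine Real.sqrt_le_sqrt (le_exp_mul_of_hasDerivAt_le hdV (fun s hs => ?_) ht)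
    have h1 := (hHFs _ (hyU s hs) _ (hPu s hs)).1
    rw [← hVu s hs] at h1
    linarith [(abs_le.1 (hvar s hs)).2]
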